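/- Assume the Generalized Continuum Hypothesis. Let κ be an infinite cardinal, 𝒟 a κ⁺-good countably incomplete ultrafilter over κ, ℒ a finite relational signature, 𝒦₁ the age of an infinite ℒ-structure, (M_t)_{t∈κ} a 𝒟-countably-conforming-from-𝒦₁ sequence of finite ℒ-structures, and M* = ∏_{t∈κ} M_t/𝒟. Let 𝒜 ∈ 𝒦₁ and suppose 𝒜 has finite small Ramsey degree in age(M*). Then 𝒜 has finite internal big Ramsey degree in M*, and T_int(𝒜, M*) ≤ d(𝒜, age(M*)). -/

import Mathlib

open FirstOrder Language CategoryTheory Filter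

universe u v w x

namespace BRD

variable (L : FirstOrder.Language.{u, v})

/-- The set of copies of `A` in `N`: substructures of `N` isomorphic to `A`. -/
def Copy (A : Type*) [L.Structure A] (N : Type*) [L.Structure N] :=
  {S : L.Substructure N // Nonempty (A ≃[L] S)}

/-- A coloring `c` takes at most `ℓ` values on the copies of `A` contained in `N'`. -/
def ChromaticLE {A : Type*} [L.Structure A] {N : Type*} [L.Structure N] {k : ℕ}
    (c : Copy L A N → Fin k) (N' : L.Substructure N) (ℓ : ℕ) : Prop :=
  ∃ vals : Finset (Fin k), vals.card ≤ ℓ ∧ ∀ S : Copy L A N, S.1 ≤ N' → c S ∈ vals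

/-- `ℓ` witnesses the small Ramsey property for `A` in the class `𝒦` : for every number of
colors `k` and every `B ∈ 𝒦` there is `C ∈ 𝒦` such that every `k`-coloring of the copies of
`A` in `C` takes at most `ℓ` values on the copies of `A` in some copy of `B` in `C`. -/
def SmallRamseyWitness (𝒦 : Set (Bundled.{w} L.Structure)) (A : Bundled.{w} L.Structure)
    (ℓ : ℕ) : Prop :=
  ∀ k : ℕ, ∀ B ∈ 𝒦, ∃ C ∈ 𝒦, ∀ c : Copy L A C → Fin k,
    ∃ B' : L.Substructure C, Nonempty (B ≃[L] B') ∧ ChromaticLE L c B' ℓ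

variable {ι : Type x} (𝒟 : Ultrafilter ι) (M : ι → Type w) [∀ t, L.Structure (M t)]

/-- The projection `𝒜[t]` of a substructure `𝒜` of the ultraproduct to coordinate `t`,
using a fixed choice of representatives: the substructure of `M t` with underlying set
`{a[t] : a ∈ 𝒜}`. -/
noncomputable def coordSub (S : L.Substructure ((𝒟 : Filter ι).Product M)) (t : ι) :
    L.Substructure (M t) :=
  Substructure.closure L
    ((fun a : (𝒟 : Filter ι).Product M =>
        (Quotient.out (s := (𝒟 : Filter ι).productSetoid M) a) t) '' S)

/-- A `k`-coloring `c` of the copies of `A` in the ultraproduct is internal if it is induced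
by coordinatewise colorings `ct` on a set `Z` of the ultrafilter: `c 𝒜' = j` iff the set of
`t ∈ Z` such that `𝒜'[t] ≅ A` and `ct t 𝒜'[t] = j` belongs to the ultrafilter. -/
def IsInternalColoring {k : ℕ} (A : Type*) [L.Structure A]
    (c : Copy L A ((𝒟 : Filter ι).Product M) → Fin k) : Prop :=
  ∃ Z ∈ 𝒟, ∃ ct : ∀ t : ι, Copy L A (M t) → Fin k,
    ∀ (A' : Copy L A ((𝒟 : Filter ι).Product M)) (j : Fin k),
      c A' = j ↔
        {t | t ∈ Z ∧ ∃ e : A ≃[L] (coordSub L 𝒟 M A'.1 t),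
          ct t ⟨coordSub L 𝒟 M A'.1 t, ⟨e⟩⟩ = j} ∈ 𝒟

/-- An ultrafilter is countably incomplete if it is not closed under countable
intersections. -/
def CountablyIncomplete {ι : Type x} (𝒟 : Ultrafilter ι) : Prop :=
  ∃ X : ℕ → Set ι, (∀ n, X n ∈ 𝒟) ∧ (⋂ n, X n) ∉ 𝒟

/-- An ultrafilter is `κ`-good if for every `α` of cardinality `< κ`, every monotone function
from finite subsets of `α` to the ultrafilter has a multiplicative refinement with values in
the ultrafilter. -/
def IsGoodUltrafilter {ι : Type x} (κ : Cardinal.{x}) (𝒟 : Ultrafilter ι) : Prop :=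
  ∀ (α : Type x) (_ : DecidableEq α), Cardinal.mk α < κ →
    ∀ f : Finset α → Set ι, (∀ u, f u ∈ 𝒟) → (∀ u v : Finset α, u ⊆ v → f v ⊆ f u) →
      ∃ g : Finset α → Set ι, (∀ u, g u ∈ 𝒟) ∧ (∀ u, g u ⊆ f u) ∧
        ∀ u v : Finset α, g (u ∪ v) = g u ∩ g v

/-- The `n`-th piece `(κ∖X_n) ∖ ⋃_{m<n}(κ∖X_m)` of the decomposition of the index set
determined by the witnessing sets `X_n`. -/
def Yset {ι : Type x} (X : ℕ → Set ι) (n : ℕ) : Set ι :=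
  (X n)ᶜ \ ⋃ m < n, (X m)ᶜ

/-- The sequence `(M t)` is `𝒟`-countably-conforming-from-`𝒦`, witnessed by `(X n)`: there
is an enumeration `(A n)` of the isomorphism types of `𝒦` forming a cofinal chain under
embeddings, the sets `X n` belong to `𝒟` and have empty intersection, and `M t` is (a copy
of) `A n` for `t` in the `n`-th piece of the induced decomposition of the index set. -/
def ConformingFrom (𝒦 : Set (Bundled.{w} L.Structure)) {ι : Type x} (𝒟 : Ultrafilter ι)
    (M : ι → Type w) [∀ t, L.Structure (M t)] (X : ℕ → Set ι) : Prop :=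
  ∃ A : ℕ → Bundled.{w} L.Structure,
    (∀ n, A n ∈ 𝒦) ∧
    (∀ n, Nonempty (A n ↪[L] A (n + 1))) ∧
    (∀ B ∈ 𝒦, ∃ n, Nonempty (B ↪[L] A n)) ∧
    (∀ n, X n ∈ 𝒟) ∧ (⋂ n, X n) = ∅ ∧
    ∀ t n, t ∈ Yset X n → Nonempty (M t ≃[L] A n)

/-- `ℓ` witnesses the internal big Ramsey property for `A` in the ultraproduct `M*`. -/
def InternalBigRamseyWitness {ι : Type x} (𝒟 : Ultrafilter ι) (M : ι → Type w)
    [∀ t, L.Structure (M t)] (A : Type*) [L.Structure A] (ℓ : ℕ) : Prop :=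
  ∀ k : ℕ, ∀ c : Copy L A ((𝒟 : Filter ι).Product M) → Fin k,
    IsInternalColoring L 𝒟 M A c →
      ∃ N' : L.Substructure ((𝒟 : Filter ι).Product M),
        Nonempty (((𝒟 : Filter ι).Product M) ≃[L] N') ∧ ChromaticLE L c N' ℓ

end BRD

namespace BRD

open Structure

section Saturation

variable {ι : Type w} {𝒟 : Ultrafilter ι} {M : ι → Type w}

/-- Ultraproducts by good, countably incomplete ultrafilters realize small families of internal
sets with the finite intersection property. -/
theorem exists_realize_of_good
    (hgood : IsGoodUltrafilter (Order.succ (Cardinal.mk ι)) 𝒟)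
    {X : ℕ → Set ι} (hX : ∀ n, X n ∈ 𝒟) (hXe : ⋂ n, X n = ∅) [∀ t, Nonempty (M t)]
    {α : Type w} (hα : Cardinal.mk α ≤ Cardinal.mk ι) (B : α → ∀ t, Set (M t))
    (hB : ∀ u : Finset α, ∀ᶠ t in 𝒟, ∃ y, ∀ i ∈ u, y ∈ B i t) :
    ∃ x : ∀ t, M t, ∀ i, ∀ᶠ t in 𝒟, x t ∈ B i t := by
  classical
  obtain ⟨g, hg, hgf, hmul⟩ := hgood α inferInstance (Order.lt_succ_iff.2 hα)
    (fun u => {t | (∀ m < u.card, t ∈ X m) ∧ ∃ y, ∀ i ∈ u, y ∈ B i t})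
    (fun u => by
      have h₁ : ∀ᶠ t in 𝒟, ∀ m ∈ Set.Iio u.card, t ∈ X m :=
        (eventually_all_finite (Set.finite_Iio _)).2 fun m _ => hX m
      exact h₁.and (hB u))
    (fun u v huv t ht => ⟨fun m hm => ht.1 m (hm.trans_le (Finset.card_le_card huv)),
      ht.2.imp fun y hy i hi => hy i (huv hi)⟩)
  have hmem : ∀ (t : ι) (u : Finset α), u.Nonempty → (∀ i ∈ u, t ∈ g {i}) → t ∈ g u := by
    intro t u hu
    induction hu using Finset.Nonempty.cons_induction with
    | singleton a => simp
    | cons a s ha hs ih =>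
      intro h
      rw [Finset.cons_eq_insert, Finset.insert_eq, hmul]
      exact ⟨h a (by simp), ih fun i hi => h i (by simp [hi])⟩
  have key : ∀ t, ∃ y : M t, ∀ i, t ∈ g {i} → y ∈ B i t := by
    intro t
    obtain ⟨n, hn⟩ : ∃ n, t ∉ X n := by
      by_contra! h
      exact (Set.ext_iff.1 hXe t).1 (Set.mem_iInter.2 h)
    have hfin : {i | t ∈ g {i}}.Finite := by
      by_contra hinf
      obtain ⟨s, hs, hcard⟩ := Set.Infinite.exists_subset_card_eq hinf (n + 1)
      have := hgf s (hmem t s (Finset.card_pos.1 (by omega)) fun i hi => hs hi)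
      exact hn (this.1 n (by omega))
    rcases hfin.toFinset.eq_empty_or_nonempty with he | hne
    · refine ⟨Classical.arbitrary _, fun i hi => ?_⟩
      have : i ∈ hfin.toFinset := by simpa using hi
      simp [he] at this
    · obtain ⟨y, hy⟩ := (hgf _ (hmem t _ hne fun i hi => by simpa using hi)).2
      exact ⟨y, fun i hi => hy i (by simpa using hi)⟩
  choose x hx using key
  exact ⟨x, fun i => mem_of_superset (hg {i}) fun t ht => hx t i ht⟩

/-- An ultraproduct of finite sets has at most `2 ^ #ι` elements. -/
theorem mk_product_le [Infinite ι] [∀ t, Finite (M t)] :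
    Cardinal.mk ((𝒟 : Filter ι).Product M) ≤ 2 ^ Cardinal.mk ι := by
  have h₁ : Cardinal.mk ((𝒟 : Filter ι).Product M) ≤ Cardinal.mk (∀ t, M t) :=
    Cardinal.mk_le_of_surjective (f := Quotient.mk ((𝒟 : Filter ι).productSetoid M))
      Quotient.mk_surjective
  have h₂ : Cardinal.mk (∀ t, M t) ≤ Cardinal.mk (ι → ULift.{w} ℕ) := by
    rw [Cardinal.mk_pi, Cardinal.mk_pi]
    exact Cardinal.prod_le_prod _ _ fun t => by simp
  refine h₁.trans (h₂.trans ?_)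
  rw [Cardinal.mk_pi, Cardinal.prod_const]
  simp only [Cardinal.mk_uLift, Cardinal.mk_nat, Cardinal.lift_aleph0, Cardinal.lift_id]
  exact (Cardinal.power_eq_two_power (Cardinal.aleph0_le_mk ι)
    (Cardinal.natCast_lt_aleph0 (n := 2)).le (Cardinal.aleph0_le_mk ι)).le

end Saturation

section PartialEmbedding

variable {L : FirstOrder.Language.{u, v}} {N P Q : Type*} [L.Structure N] [L.Structure P]
  [L.Structure Q]

variable (L) in
/-- `g` restricts to an isomorphism of relational structures from `F` onto its image. -/
def IsPartialEmbedding (F : Set N) (g : N → P) : Prop :=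
  Set.InjOn g F ∧ ∀ (n : ℕ) (r : L.Relations n) (x : Fin n → N), (∀ i, x i ∈ F) →
    (RelMap r (fun i => g (x i)) ↔ RelMap r x)

theorem IsPartialEmbedding.mono {F F' : Set N} {g : N → P} (h : IsPartialEmbedding L F g)
    (hF : F' ⊆ F) : IsPartialEmbedding L F' g :=
  ⟨h.1.mono hF, fun n r x hx => h.2 n r x fun i => hF (hx i)⟩

theorem IsPartialEmbedding.comp {F : Set N} {g : N → P} (h : IsPartialEmbedding L F g)
    {g' : P → Q} {F' : Set P} (h' : IsPartialEmbedding L F' g') (hF : Set.MapsTo g F F') :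
    IsPartialEmbedding L F (g' ∘ g) :=
  ⟨h'.1.comp h.1 hF, fun n r x hx =>
    (h'.2 n r (fun i => g (x i)) fun i => hF (hx i)).trans (h.2 n r x hx)⟩

theorem _root_.FirstOrder.Language.Embedding.isPartialEmbedding (φ : N ↪[L] P) (F : Set N) :
    IsPartialEmbedding L F φ :=
  ⟨φ.injective.injOn, fun _ r x _ => φ.map_rel r x⟩

variable (L) in
/-- Some partial embedding of `F` with values in `W` agrees with `e` on `S`. -/
def Extends (W : Set P) (S : Set N) (e : N → P) (F : Set N) : Prop :=
  ∃ g : N → P, IsPartialEmbedding L F g ∧ Set.MapsTo g F W ∧ Set.EqOn g e (F ∩ S)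

theorem Extends.mono {W : Set P} {S : Set N} {e : N → P} {F F' : Set N}
    (h : Extends L W S e F) (hF : F' ⊆ F) : Extends L W S e F' :=
  h.imp fun _ hg => ⟨hg.1.mono hF, hg.2.1.mono_left hF,
    hg.2.2.mono (Set.inter_subset_inter_left _ hF)⟩

variable (L) in
/-- The isomorphism type over `S` of a finite tuple: which entries lie in `S`, and which relations
hold between the entries. -/
noncomputable def tupleType (S : Set N) {n : ℕ} (f : Fin n → N) :
    (Fin n → Option S) × ((Σ r : (Σ m, L.Relations m), Fin r.1 → Fin n) → Prop) :=
  open Classical in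
  (fun i => if h : f i ∈ S then some ⟨f i, h⟩ else none, fun x => RelMap x.1.2 (f ∘ x.2))

theorem Extends.of_tupleType_eq {W : Set P} {S : Set N} {e : N → P} {n : ℕ} {f f' : Fin n → N}
    (hf : Function.Injective f) (hf' : Function.Injective f')
    (h : tupleType L S f = tupleType L S f')
    (hE : Extends L W S e (Set.range f)) : Extends L W S e (Set.range f') := by
  classical
  obtain ⟨g, hg, hgW, hge⟩ := hE
  have hS : ∀ i, f' i ∈ S → f i = f' i := by
    intro i hi
    have := congrFun (congrArg Prod.fst h) i
    simp only [tupleType, hi, dite_true] at this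
    split_ifs at this with h'
    simpa using this
  have hR : ∀ m (r : L.Relations m) (j : Fin m → Fin n),
      RelMap r (fun i => f (j i)) ↔ RelMap r (fun i => f' (j i)) := fun m r j =>
    iff_of_eq (congrFun (congrArg Prod.snd h) ⟨⟨m, r⟩, j⟩)
  rcases isEmpty_or_nonempty (Fin n) with hn | hn
  · refine ⟨g, ⟨?_, ?_⟩, ?_, ?_⟩
    · simp [Set.range_eq_empty]
    · intro m r x hx
      rcases isEmpty_or_nonempty (Fin m) with hm | ⟨⟨i⟩⟩
      · exact hg.2 m r x fun i => isEmptyElim i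
      · simpa [Set.range_eq_empty] using hx i
    · simp [Set.range_eq_empty, Set.MapsTo]
    · simp [Set.range_eq_empty]
  have hinv : ∀ i, Function.invFun f' (f' i) = i := Function.leftInverse_invFun hf'
  refine ⟨fun y => g (f (Function.invFun f' y)), ⟨?_, ?_⟩, ?_, ?_⟩
  · rintro _ ⟨i, rfl⟩ _ ⟨j, rfl⟩ hij
    simp only [hinv] at hij
    rw [hf (hg.1 ⟨i, rfl⟩ ⟨j, rfl⟩ hij)]
  · intro m r x hx
    choose j hj using hx
    obtain rfl : (fun i => f' (j i)) = x := funext hj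
    simp only [hinv]
    exact (hg.2 m r (fun i => f (j i)) fun i => ⟨_, rfl⟩).trans (hR m r j)
  · rintro _ ⟨i, rfl⟩
    simp only [hinv]
    exact hgW ⟨i, rfl⟩
  · rintro _ ⟨⟨i, rfl⟩, hi⟩
    simp only [hinv]
    rw [hS i hi]
    exact hge ⟨⟨i, hS i hi⟩, hi⟩

/-- There are few isomorphism types of finite tuples over a set `S`. -/
theorem exists_embedding_tupleType [Finite (Σ n, L.Relations n)] {ι : Type w} [Infinite ι]
    {N : Type w} {S : Set N} (hS : Cardinal.mk S ≤ Cardinal.mk ι) :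
    Nonempty ((Σ n, (Fin n → Option S) ×
      ((Σ r : (Σ m, L.Relations m), Fin r.1 → Fin n) → Prop)) ↪ ι) := by
  obtain ⟨j, hj⟩ := exists_injective_nat
    (Σ n, ((Σ r : (Σ m, L.Relations m), Fin r.1 → Fin n) → Prop))
  have hcard : Cardinal.mk (List (Option S) × ULift.{w} ℕ) ≤ Cardinal.mk ι := by
    have hι := Cardinal.aleph0_le_mk ι
    have h₁ : Cardinal.mk (List (Option S)) ≤ Cardinal.mk ι := by
      refine (Cardinal.mk_list_le_max _).trans (max_le hι ?_)
      rw [Cardinal.mk_option]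
      exact Cardinal.add_le_of_le hι hS (Cardinal.one_le_aleph0.trans hι)
    rw [Cardinal.mk_prod]
    simpa using Cardinal.mul_le_of_le hι h₁ hι
  obtain ⟨φ⟩ := hcard
  refine ⟨Function.Embedding.trans ⟨fun c => (List.ofFn c.2.1, ⟨j ⟨c.1, c.2.2⟩⟩), ?_⟩ φ⟩
  rintro ⟨n, p, q⟩ ⟨n', p', q'⟩ h
  simp only [Prod.mk.injEq, ULift.up.injEq] at h
  obtain ⟨rfl, hq⟩ := Sigma.mk.inj_iff.1 (hj h.2)
  obtain rfl := List.ofFn_injective h.1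
  obtain rfl := eq_of_heq hq
  rfl

end PartialEmbedding

section Universality

variable {L : FirstOrder.Language.{u, v}} {ι : Type w} {𝒟 : Ultrafilter ι} {M : ι → Type w}
  [∀ t, L.Structure (M t)] {N : Type w} [L.Structure N]

theorem exists_extends_insert [Finite (Σ n, L.Relations n)] [Infinite ι]
    (hgood : IsGoodUltrafilter (Order.succ (Cardinal.mk ι)) 𝒟)
    {X : ℕ → Set ι} (hX : ∀ n, X n ∈ 𝒟) (hXe : ⋂ n, X n = ∅) [∀ t, Nonempty (M t)]
    (W : ∀ t, Set (M t)) (S : Set N) (hS : Cardinal.mk S ≤ Cardinal.mk ι) {a : N} (ha : a ∉ S)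
    (e : N → ∀ t, M t)
    (he : ∀ F : Finset N, ∀ᶠ t in 𝒟, Extends L (W t) S (fun x => e x t) F) :
    ∃ b : ∀ t, M t, ∀ F : Finset N, ∀ᶠ t in 𝒟,
      Extends L (W t) (insert a S) (open Classical in Function.update (fun x => e x t) a (b t))
        F := by
  classical
  have hS' : Cardinal.mk (insert a S : Set N) ≤ Cardinal.mk ι :=
    Cardinal.mk_insert_le.trans (Cardinal.add_le_of_le (Cardinal.aleph0_le_mk ι) hS
      (Cardinal.one_le_aleph0.trans (Cardinal.aleph0_le_mk ι)))
  set B : Finset N → ∀ t, Set (M t) := fun F t =>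
    {y | Extends L (W t) (insert a S) (Function.update (fun x => e x t) a y) F} with hBdef
  have henum : ∀ F : Finset N, ∃ f : Fin F.card → N, Function.Injective f ∧ Set.range f = F :=
    fun F => ⟨fun i => F.equivFin.symm i,
      Subtype.val_injective.comp F.equivFin.symm.injective, by
        rw [show (fun i => (F.equivFin.symm i : N)) = Subtype.val ∘ F.equivFin.symm from rfl,
          F.equivFin.symm.surjective.range_comp]
        simp⟩
  choose f hf hfr using henum
  obtain ⟨φ⟩ := exists_embedding_tupleType (L := L) hS'
  have hcode : ∀ {n n' : ℕ} (f : Fin n → N) (f' : Fin n' → N), Function.Injective f →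
      Function.Injective f' →
      (⟨n, tupleType L (insert a S) f⟩ : Σ n, (Fin n → Option (insert a S : Set N)) ×
        ((Σ r : (Σ m, L.Relations m), Fin r.1 → Fin n) → Prop)) =
        ⟨n', tupleType L (insert a S) f'⟩ →
      ∀ t y, Extends L (W t) (insert a S) (Function.update (fun x => e x t) a y) (Set.range f) →
        Extends L (W t) (insert a S) (Function.update (fun x => e x t) a y) (Set.range f') := by
    intro n n' f f' hf hf' h t y hE
    obtain ⟨rfl, h⟩ := Sigma.mk.inj_iff.1 h
    exact hE.of_tupleType_eq hf hf' (eq_of_heq h)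
  have hα : Cardinal.mk (Set.range B) ≤ Cardinal.mk ι := by
    choose F hF using fun b : Set.range B => b.2
    refine Cardinal.mk_le_of_injective
      (f := fun b => φ ⟨_, tupleType L (insert a S) (f (F b))⟩) fun b b' h => ?_
    have h := φ.injective h
    refine Subtype.ext ?_
    rw [← hF b, ← hF b']
    funext t
    ext y
    simp only [hBdef, Set.mem_ofPred_eq]
    rw [← hfr, ← hfr]
    exact ⟨hcode _ _ (hf _) (hf _) h t y, hcode _ _ (hf _) (hf _) h.symm t y⟩
  obtain ⟨b, hb⟩ := exists_realize_of_good hgood hX hXe hα (fun b => b.1) (fun u => by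
    choose F hF using fun b : Set.range B => b.2
    filter_upwards [he (insert a (u.biUnion F))] with t ht
    obtain ⟨g, hg, hgW, hge⟩ := ht
    refine ⟨g a, fun i hi => ?_⟩
    have hsub : (F i : Set N) ⊆ (insert a (u.biUnion F) : Finset N) := by
      intro x hx
      simp only [Finset.coe_insert, Set.mem_insert_iff, Finset.mem_coe, Finset.mem_biUnion]
      exact Or.inr ⟨i, hi, hx⟩
    rw [← hF i]
    refine ⟨g, hg.mono hsub, hgW.mono_left hsub, ?_⟩
    rintro x ⟨hxF, rfl | hxS⟩
    · simp
    · rw [Function.update_of_ne (by rintro rfl; exact ha hxS)]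
      exact hge ⟨hsub hxF, hxS⟩)
  exact ⟨b, fun F => hb ⟨B F, F, rfl⟩⟩

/-- An ultraproduct by a good, countably incomplete ultrafilter over `ι` is universal for
structures of size at most `(#ι)⁺` whose finite substructures embed in it, in a version relative to
an internal subset of the ultraproduct. -/
theorem exists_internal_embedding [Finite (Σ n, L.Relations n)] [Infinite ι]
    (hgood : IsGoodUltrafilter (Order.succ (Cardinal.mk ι)) 𝒟)
    {X : ℕ → Set ι} (hX : ∀ n, X n ∈ 𝒟) (hXe : ⋂ n, X n = ∅) [∀ t, Nonempty (M t)]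
    (hN : Cardinal.mk N ≤ Order.succ (Cardinal.mk ι)) (W : ∀ t, Set (M t))
    (hW : ∀ F : Finset N, ∀ᶠ t in 𝒟, ∃ g : N → M t,
      IsPartialEmbedding L (F : Set N) g ∧ Set.MapsTo g F (W t)) :
    ∃ E : N → ∀ t, M t, ∀ F : Finset N, ∀ᶠ t in 𝒟,
      Extends L (W t) Set.univ (fun x => E x t) F := by
  classical
  obtain ⟨_, _, hord⟩ := Cardinal.exists_ord_eq_type_lt N
  let Inv : Set N → (N → ∀ t, M t) → Prop := fun S e =>
    ∀ F : Finset N, ∀ᶠ t in 𝒟, Extends L (W t) S (fun x => e x t) F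
  have hcongr : ∀ S e e', (∀ x ∈ S, e x = e' x) → Inv S e → Inv S e' := by
    intro S e e' h hInv F
    filter_upwards [hInv F] with t ht
    obtain ⟨g, h₁, h₂, h₃⟩ := ht
    exact ⟨g, h₁, h₂, fun x hx => (h₃ hx).trans (congrFun (h x hx.2) t)⟩
  have hstep : ∀ (a : N) (e : N → ∀ t, M t), ∃ b : ∀ t, M t,
      Inv (Set.Iio a) e → Inv (Set.Iic a) (Function.update e a b) := by
    intro a e
    by_cases h : Inv (Set.Iio a) e
    · obtain ⟨b, hb⟩ := exists_extends_insert hgood hX hXe W (Set.Iio a)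
        (Order.lt_succ_iff.1 ((Cardinal.mk_Iio_lt a hord).trans_le hN)) (lt_irrefl a) e h
      refine ⟨b, fun _ F => ?_⟩
      filter_upwards [hb F] with t ht
      rw [Set.Iio_insert] at ht
      convert ht using 1
      funext x
      by_cases hx : x = a
      · subst hx; simp
      · simp [hx]
    · exact ⟨fun t => Classical.arbitrary _, fun h' => absurd h' h⟩
  choose b hb using hstep
  let E : N → ∀ t, M t := (wellFounded_lt (α := N)).fix fun a ih =>
    b a fun x => if hx : x < a then ih x hx else fun t => Classical.arbitrary _
  have hE : ∀ a, E a = b a fun x => if x < a then E x else fun t => Classical.arbitrary _ := by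
    intro a
    exact (wellFounded_lt (α := N)).fix_eq _ a
  have hlim : ∀ S : Set N, (∀ a ∈ S, Set.Iic a ⊆ S ∧ Inv (Set.Iic a) E) → Inv S E := by
    intro S hS F
    rcases (F.filter (· ∈ S)).eq_empty_or_nonempty with he | hne
    · filter_upwards [hW F] with t ht
      obtain ⟨g, h₁, h₂⟩ := ht
      refine ⟨g, h₁, h₂, fun x hx => ?_⟩
      have : x ∈ F.filter (· ∈ S) := by simpa using hx
      simp [he] at this
    · have hm := Finset.max'_mem _ hne
      filter_upwards [(hS _ (Finset.mem_filter.1 hm).2).2 F] with t ht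
      obtain ⟨g, h₁, h₂, h₃⟩ := ht
      refine ⟨g, h₁, h₂, fun x hx => h₃ ⟨hx.1, ?_⟩⟩
      exact Finset.le_max' _ _ (by simpa using hx)
  have hall : ∀ a, Inv (Set.Iic a) E := by
    intro a
    induction a using (wellFounded_lt (α := N)).induction with
    | _ a ih =>
      have h₁ : Inv (Set.Iio a) E :=
        hlim _ fun x hx => ⟨fun y hy => lt_of_le_of_lt hy hx, ih x hx⟩
      have h₂ := hb a (fun x => if x < a then E x else fun t => Classical.arbitrary _)
        (hcongr _ _ _ (fun x hx => by simp [Set.mem_Iio.1 hx]) h₁)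
      refine hcongr _ _ _ (fun x hx => ?_) h₂
      rcases (Set.mem_Iic.1 hx).lt_or_eq with hlt | rfl
      · simp [hlt, hlt.ne]
      · simp only [Function.update_self]
        exact (hE x).symm
  exact ⟨E, hlim _ fun a _ => ⟨Set.subset_univ _, hall a⟩⟩

end Universality

theorem Extends.of_univ {L : FirstOrder.Language.{u, v}} {N P : Type*} [L.Structure N]
    [L.Structure P] {W : Set P} {e : N → P} {F : Set N} (h : Extends L W Set.univ e F) :
    IsPartialEmbedding L F e ∧ Set.MapsTo e F W := by
  obtain ⟨g, hg, hgW, hge⟩ := h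
  rw [Set.inter_univ] at hge
  refine ⟨⟨hg.1.congr hge, fun n r x hx => ?_⟩, hgW.congr hge⟩
  rw [← hg.2 n r x hx, show (fun i => e (x i)) = fun i => g (x i) from
    funext fun i => (hge (hx i)).symm]

section Product

variable {L : FirstOrder.Language.{u, v}} {ι : Type*} {𝒟 : Ultrafilter ι} {M : ι → Type*}
  [∀ t, L.Structure (M t)]

theorem relMap_product_mk {n : ℕ} (r : L.Relations n) (x : Fin n → ∀ t, M t) :
    RelMap r (fun i => (x i : (𝒟 : Filter ι).Product M)) ↔
      ∀ᶠ t in 𝒟, RelMap r fun i => x i t :=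
  relMap_quotient_mk' (s := (𝒟 : Filter ι).productSetoid M)
    (ps := Ultraproduct.setoidPrestructure M 𝒟) r x

/-- Coordinatewise partial embeddings induce an embedding in the ultraproduct. -/
theorem exists_embedding_product [L.IsRelational] {N : Type*} [L.Structure N]
    (E : N → ∀ t, M t)
    (hE : ∀ F : Finset N, ∀ᶠ t in 𝒟, IsPartialEmbedding L (F : Set N) (fun x => E x t)) :
    ∃ Φ : N ↪[L] (𝒟 : Filter ι).Product M,
      ∀ x, Φ x = (E x : (𝒟 : Filter ι).Product M) := by
  classical
  refine ⟨⟨⟨fun x => (E x : (𝒟 : Filter ι).Product M), fun x y hxy => ?_⟩,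
    fun f => isEmptyElim f, fun {n} r x => ?_⟩, fun x => rfl⟩
  · have h : ∀ᶠ t in 𝒟, E x t = E y t :=
      Quotient.exact (s := (𝒟 : Filter ι).productSetoid M) hxy
    obtain ⟨t, h₁, h₂⟩ := (h.and (hE {x, y})).exists
    exact h₂.1 (by simp) (by simp) h₁
  · refine (relMap_product_mk r fun i => E (x i)).trans ?_
    have h : ∀ᶠ t in 𝒟, (RelMap r (fun i => E (x i) t) ↔ RelMap r x) := by
      filter_upwards [hE (Finset.univ.image x)] with t ht
      exact ht.2 n r x fun i => by simp
    rw [eventually_congr h, eventually_const]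

/-- Representatives of finitely many elements of an ultraproduct have the same isomorphism type as
those elements in almost all coordinates. -/
theorem eventually_isPartialEmbedding_out [Finite (Σ n, L.Relations n)]
    (F : Finset ((𝒟 : Filter ι).Product M)) :
    ∀ᶠ t in 𝒟, IsPartialEmbedding L (F : Set ((𝒟 : Filter ι).Product M))
      (fun x => Quotient.out (s := (𝒟 : Filter ι).productSetoid M) x t) := by
  have hinj : ∀ᶠ t in 𝒟, ∀ p : F × F,
      Quotient.out (s := (𝒟 : Filter ι).productSetoid M) p.1.1 t =
        Quotient.out (s := (𝒟 : Filter ι).productSetoid M) p.2.1 t → p.1.1 = p.2.1 := by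
    refine eventually_all.2 fun p => ?_
    by_cases h : p.1.1 = p.2.1
    · exact Eventually.of_forall fun _ _ => h
    · have : ¬ ∀ᶠ t in 𝒟, Quotient.out (s := (𝒟 : Filter ι).productSetoid M) p.1.1 t =
          Quotient.out (s := (𝒟 : Filter ι).productSetoid M) p.2.1 t := fun h' =>
        h (Quotient.out_equiv_out.1 h')
      exact (Ultrafilter.eventually_not.2 this).mono fun t ht h' => absurd h' ht
  have hrel : ∀ᶠ t in 𝒟, ∀ p : Σ r : (Σ n, L.Relations n), Fin r.1 → F,
      (RelMap p.1.2 (fun i => Quotient.out (s := (𝒟 : Filter ι).productSetoid M) (p.2 i).1 t) ↔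
        RelMap p.1.2 fun i => (p.2 i).1) := by
    refine eventually_all.2 fun p => ?_
    have h := relMap_product_mk (𝒟 := 𝒟) p.1.2 fun i =>
      Quotient.out (s := (𝒟 : Filter ι).productSetoid M) (p.2 i).1
    have h' : (fun i => ((Quotient.out (s := (𝒟 : Filter ι).productSetoid M) (p.2 i).1 :
        ∀ t, M t) : (𝒟 : Filter ι).Product M)) = fun i => (p.2 i).1 :=
      funext fun i => Quotient.out_eq _
    rw [h'] at h
    by_cases hr : RelMap p.1.2 fun i => (p.2 i).1
    · exact (h.1 hr).mono fun t ht => iff_of_true ht hr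
    · exact (Ultrafilter.eventually_not.2 fun h₁ => hr (h.2 h₁)).mono
        fun t ht => iff_of_false ht hr
  filter_upwards [hinj, hrel] with t h₁ h₂
  exact ⟨fun x hx y hy hxy => h₁ (⟨x, hx⟩, ⟨y, hy⟩) hxy,
    fun n r x hx => h₂ ⟨⟨n, r⟩, fun i => ⟨x i, hx i⟩⟩⟩

end Product

/-- A Ramsey property of `C` passes to structures in which `C` embeds. -/
theorem exists_embedding_chromaticLE {L : FirstOrder.Language.{u, v}} {A B C P : Type*}
    [L.Structure A] [L.Structure B] [L.Structure C] [L.Structure P] {k ℓ : ℕ} (j : C ↪[L] P)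
    (hC : ∀ c : Copy L A C → Fin k,
      ∃ B' : L.Substructure C, Nonempty (B ≃[L] B') ∧ ChromaticLE L c B' ℓ)
    (c : Copy L A P → Fin k) : ∃ φ : B ↪[L] P, ChromaticLE L c φ.toHom.range ℓ := by
  obtain ⟨B', ⟨e⟩, vals, hcard, hvals⟩ := hC fun S =>
    c ⟨S.1.map j.toHom, S.2.map fun e => (j.substructureEquivMap S.1).comp e⟩
  refine ⟨j.comp (B'.subtype.comp e.toEmbedding), vals, hcard, fun S hS => ?_⟩
  have hmap : (S.1.comap j.toHom).map j.toHom = S.1 := by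
    refine le_antisymm Substructure.map_comap_le fun x hx => ?_
    obtain ⟨b, rfl⟩ := hS hx
    exact ⟨e b, hx, rfl⟩
  have hiso : Nonempty (A ≃[L] S.1.comap j.toHom) := by
    obtain ⟨f⟩ := S.2
    rw [← hmap] at f
    exact ⟨(j.substructureEquivMap _).symm.comp f⟩
  have := hvals ⟨S.1.comap j.toHom, hiso⟩ (fun x hx => by
    obtain ⟨b, hb⟩ := hS hx
    rw [← j.injective hb]
    exact (e b).2)
  have hS' : (⟨(S.1.comap j.toHom).map j.toHom,
      hiso.map fun e => (j.substructureEquivMap _).comp e⟩ : Copy L A P) = S := Subtype.ext hmap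
  rwa [← hS']

variable (L : FirstOrder.Language.{u, v})

/-- Corollary under GCH: in the setting of the general theorem, assuming
the Generalized Continuum Hypothesis, if `𝒜 ∈ 𝒦₁` has finite small Ramsey degree `d` in
`age M*`, then `𝒜` has finite internal big Ramsey degree `T` in `M*` with `T ≤ d`. -/
theorem internal_big_ramsey_of_small_ramsey_GCH
    (GCH : ∀ κ : Cardinal.{w}, Cardinal.aleph0 ≤ κ → 2 ^ κ = Order.succ κ)
    [L.IsRelational] [Finite (Σ n, L.Relations n)]
    (ι : Type w) (hι : Infinite ι)
    (𝒟 : Ultrafilter ι)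
    (hgood : IsGoodUltrafilter (Order.succ (Cardinal.mk ι)) 𝒟)
    (hinc : CountablyIncomplete 𝒟)
    (𝒦₁ : Set (Bundled.{w} L.Structure))
    (h𝒦₁ : ∃ (N₀ : Type w) (S : L.Structure N₀), Infinite N₀ ∧ 𝒦₁ = @Language.age L N₀ S)
    (M : ι → Type w) [∀ t, L.Structure (M t)] [∀ t, Finite (M t)]
    (X : ℕ → Set ι) (hconf : ConformingFrom L 𝒦₁ 𝒟 M X)
    (A : Bundled.{w} L.Structure) (hA : A ∈ 𝒦₁)
    (d : ℕ)
    (hd : IsLeast {ℓ : ℕ | SmallRamseyWitness L (L.age ((𝒟 : Filter ι).Product M)) A ℓ} d) :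
    ∃ T : ℕ, IsLeast {ℓ : ℕ | InternalBigRamseyWitness L 𝒟 M A ℓ} T ∧ T ≤ d := by
  classical
  suffices h : InternalBigRamseyWitness L 𝒟 M A d by
    have hex : ∃ ℓ, InternalBigRamseyWitness L 𝒟 M A ℓ := ⟨d, h⟩
    exact ⟨Nat.find hex, ⟨Nat.find_spec hex, fun ℓ hℓ => Nat.find_min' hex hℓ⟩,
      Nat.find_min' hex h⟩
  rintro k c ⟨Z, hZ, ct, hct⟩
  rcases em (∃ t, IsEmpty (M t)) with ⟨t₀, ht₀⟩ | hne
  · have hempty : IsEmpty ((𝒟 : Filter ι).Product M) :=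
      ⟨fun x => ht₀.false (Quotient.out (s := (𝒟 : Filter ι).productSetoid M) x t₀)⟩
    obtain ⟨C, ⟨_, ⟨j⟩⟩, hC⟩ := hd.1 k (Bundled.of ((𝒟 : Filter ι).Product M))
      ⟨Structure.fg_iff_finite.2 (inferInstanceAs (Finite ((𝒟 : Filter ι).Product M))),
        ⟨Embedding.refl L _⟩⟩
    obtain ⟨φ, hφ⟩ := exists_embedding_chromaticLE j hC c
    exact ⟨φ.toHom.range, ⟨φ.equivRange⟩, hφ⟩
  simp only [not_exists, not_isEmpty_iff] at hne
  obtain ⟨N₀, _, _, rfl⟩ := h𝒦₁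
  obtain ⟨K, hK, hKs, -, hX, hXe, hM⟩ := hconf
  have hAfin : Finite A := Structure.fg_iff_finite.1 hA.1
  have hKle : ∀ {m n : ℕ}, m ≤ n → Nonempty (K m ↪[L] K n) := by
    intro m n hmn
    induction n, hmn using Nat.le_induction with
    | base => exact ⟨Embedding.refl L _⟩
    | succ n _ ih => exact ⟨(hKs n).some.comp ih.some⟩
  have hidx : ∀ t, ∃ n, t ∈ Yset X n := by
    intro t
    have hex : ∃ n, t ∉ X n := by
      by_contra! h
      exact (Set.ext_iff.1 hXe t).1 (Set.mem_iInter.2 h)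
    refine ⟨Nat.find hex, Nat.find_spec hex, ?_⟩
    simp only [Set.mem_iUnion, not_exists]
    exact fun m hm hmt => Nat.find_min hex hm hmt
  choose idx hidx using hidx
  have hMK : ∀ t, Nonempty (M t ≃[L] K (idx t)) := fun t => hM t _ (hidx t)
  have hidx_ge : ∀ n, ∀ᶠ t in 𝒟, n ≤ idx t := by
    intro n
    have h : ∀ᶠ t in 𝒟, ∀ m ∈ Set.Iio n, t ∈ X m :=
      (eventually_all_finite (Set.finite_Iio _)).2 fun m _ => hX m
    filter_upwards [h] with t ht
    by_contra! hlt
    exact (hidx t).1 (ht _ hlt)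
  have hKM : ∀ n t, n ≤ idx t → Nonempty (K n ↪[L] M t) := fun n t h =>
    ⟨(hMK t).some.symm.toEmbedding.comp (hKle h).some⟩
  have hKage : ∀ n, K n ∈ L.age ((𝒟 : Filter ι).Product M) := by
    intro n
    obtain ⟨φ, -⟩ := exists_embedding_product (N := K n) (𝒟 := 𝒟)
      (fun x t => if h : n ≤ idx t then (hKM n t h).some x else Classical.arbitrary _)
      (fun F => by
        filter_upwards [hidx_ge n] with t ht
        simp only [ht, dite_true]
        exact (hKM n t ht).some.isPartialEmbedding _)
    exact ⟨(hK n).1, ⟨φ⟩⟩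
  have hfinite : ∀ F : Finset ((𝒟 : Filter ι).Product M), ∃ n, ∃ g : _ → K n,
      IsPartialEmbedding L (F : Set ((𝒟 : Filter ι).Product M)) g := by
    intro F
    obtain ⟨t, ht⟩ := (eventually_isPartialEmbedding_out (L := L) (𝒟 := 𝒟) (M := M) F).exists
    exact ⟨idx t, _, ht.comp ((hMK t).some.toEmbedding.isPartialEmbedding Set.univ)
      (Set.mapsTo_univ _ _)⟩
  have hgood_n : ∀ n, ∀ᶠ t in 𝒟, ∃ φ : K n ↪[L] M t, ChromaticLE L (ct t) φ.toHom.range d := by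
    intro n
    obtain ⟨C, ⟨hCfg, ⟨j⟩⟩, hC⟩ := hd.1 k (K n) (hKage n)
    have hCfin : Finite C := Structure.fg_iff_finite.1 hCfg
    obtain ⟨m, g, hg⟩ := hfinite (Set.finite_range j).toFinset
    obtain ⟨j'⟩ : Nonempty (C ↪[L] K m) := by
      have h := (j.isPartialEmbedding Set.univ).comp hg (fun x _ => by simp)
      exact ⟨⟨⟨g ∘ j, Set.injOn_univ.1 h.1⟩, fun f => isEmptyElim f,
        fun r x => h.2 _ r x fun _ => trivial⟩⟩
    filter_upwards [hidx_ge m] with t ht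
    exact exists_embedding_chromaticLE ((hKM m t ht).some.comp j') hC (ct t)
  let good : ι → ℕ → Prop := fun t n => ∃ φ : K n ↪[L] M t, ChromaticLE L (ct t) φ.toHom.range d
  let h : ι → ℕ := fun t => Nat.findGreatest (good t) (idx t)
  have hh_ge : ∀ n, ∀ᶠ t in 𝒟, n ≤ h t := by
    intro n
    filter_upwards [hgood_n n, hidx_ge n] with t h₁ h₂
    exact Nat.le_findGreatest h₂ h₁
  have hh_good : ∀ᶠ t in 𝒟, good t (h t) := by
    filter_upwards [hgood_n 0] with t h₁
    exact Nat.findGreatest_spec (P := good t) (Nat.zero_le _) h₁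
  have hloc : ∀ t, ∃ (W : L.Substructure (M t)) (vals : Finset (Fin k)), good t (h t) →
      (∃ φ : K (h t) ↪[L] M t, φ.toHom.range = W) ∧ vals.card ≤ d ∧
        ∀ S : Copy L A (M t), S.1 ≤ W → ct t S ∈ vals := by
    intro t
    by_cases hg : good t (h t)
    · obtain ⟨φ, vals, hv⟩ := hg
      exact ⟨φ.toHom.range, vals, fun _ => ⟨⟨φ, rfl⟩, hv⟩⟩
    · exact ⟨⊤, ∅, fun h' => absurd h' hg⟩
  choose W vals hWv using hloc
  obtain ⟨vals₀, hvals₀⟩ : ∃ vals₀, ∀ᶠ t in 𝒟, vals t = vals₀ := by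
    obtain ⟨a, ha⟩ := Ultrafilter.eq_pure_of_finite (𝒟.map vals)
    refine ⟨a, ?_⟩
    have : {a} ∈ 𝒟.map vals := by rw [ha]; exact Set.mem_singleton a
    exact this
  have hcard : Cardinal.mk ((𝒟 : Filter ι).Product M) ≤ Order.succ (Cardinal.mk ι) :=
    mk_product_le.trans (GCH _ (Cardinal.aleph0_le_mk ι)).le
  obtain ⟨E, hE⟩ := exists_internal_embedding (L := L) hgood hX hXe hcard
    (fun t => (W t : Set (M t))) (fun F => by
      obtain ⟨n, g, hg⟩ := hfinite F
      filter_upwards [hh_ge n, hh_good] with t h₁ h₂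
      obtain ⟨φ, hφ⟩ := (hWv t h₂).1
      refine ⟨_, hg.comp ((φ.comp (hKle h₁).some).isPartialEmbedding Set.univ)
        (Set.mapsTo_univ _ _), fun x _ => ?_⟩
      rw [← hφ]
      exact ⟨_, rfl⟩)
  have hE' : ∀ F : Finset ((𝒟 : Filter ι).Product M), ∀ᶠ t in 𝒟,
      IsPartialEmbedding L (F : Set ((𝒟 : Filter ι).Product M)) (fun x => E x t) ∧
        Set.MapsTo (fun x => E x t) F (W t) := fun F => (hE F).mono fun t ht => ht.of_univ
  obtain ⟨Φ, hΦ⟩ := exists_embedding_product (𝒟 := 𝒟) E fun F => (hE' F).mono fun t ht => ht.1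
  refine ⟨Φ.toHom.range, ⟨Φ.equivRange⟩, vals₀, ?_, fun S hS => ?_⟩
  · obtain ⟨t, h₁, h₂⟩ := (hh_good.and hvals₀).exists
    exact h₂ ▸ (hWv t h₁).2.1
  · have hSfin : Finite S.1 := Finite.of_equiv A S.2.some.toEquiv
    have hSW : ∀ᶠ t in 𝒟, coordSub L 𝒟 M S.1 t ≤ W t := by
      have h₁ : ∀ᶠ t in 𝒟, ∀ a ∈ (S.1 : Set ((𝒟 : Filter ι).Product M)),
          Quotient.out (s := (𝒟 : Filter ι).productSetoid M) a t ∈ W t := by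
        refine (eventually_all_finite (Set.toFinite _)).2 fun a ha => ?_
        obtain ⟨x, rfl⟩ := hS ha
        have h₂ : ∀ᶠ t in 𝒟,
            Quotient.out (s := (𝒟 : Filter ι).productSetoid M) (Φ x) t = E x t := by
          rw [hΦ]
          exact Quotient.mk_out (s := (𝒟 : Filter ι).productSetoid M) (E x)
        filter_upwards [h₂, hE' {x}] with t h₃ h₄
        have h₅ : E x t ∈ W t := h₄.2 (show x ∈ _ by simp)
        rw [← h₃] at h₅
        exact h₅
      filter_upwards [h₁] with t ht
      refine (Substructure.closure_le).2 ?_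
      rintro _ ⟨a, ha, rfl⟩
      exact ht a ha
    have hcS : ∀ᶠ t in 𝒟, t ∈ Z ∧ ∃ e : A ≃[L] (coordSub L 𝒟 M S.1 t),
        ct t ⟨coordSub L 𝒟 M S.1 t, ⟨e⟩⟩ = c S := (hct S (c S)).1 rfl
    obtain ⟨t, h₁, ⟨_, e, he⟩, h₂, h₃⟩ := (hSW.and (hcS.and (hh_good.and hvals₀))).exists
    rw [← he, ← h₃]
    exact (hWv t h₂).2.2 _ h₁

end BRD
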